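/- arXiv:2104.12435 — 3 statements merged into one kernel-verified Lean document; each statement's English description precedes it below -/
import Mathlib

section
/- The number of sequences (a(0), a(1), …, a(H−1)) of natural numbers of length H with a(0) = 0 such that a(k+1) ≤ a(k) + 1 for every 0 ≤ k ≤ H−2 equals the Catalan number C_H = (2H)! / (H! (H+1)!). -/
/-- Sequences of length `n` which start at most at `m` and whose steps increase by at most one. -/
def boundedStepSequences (n m : ℕ) : Set (Fin n → ℕ) :=
  {f | (∀ i : Fin n, (i : ℕ) = 0 → f i ≤ m) ∧
    ∀ i j : Fin n, (j : ℕ) = (i : ℕ) + 1 → f j ≤ f i + 1}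

theorem cons_mem_boundedStepSequences {n m v : ℕ} {g : Fin n → ℕ} :
    (Fin.cons v g : Fin (n + 1) → ℕ) ∈ boundedStepSequences (n + 1) m ↔
      v ≤ m ∧ g ∈ boundedStepSequences n (v + 1) := by
  constructor
  · rintro ⟨h0, hs⟩
    refine ⟨by simpa using h0 0 rfl, fun i hi ↦ ?_, fun i j hij ↦ ?_⟩
    · simpa using hs 0 i.succ (by simp [hi])
    · simpa using hs i.succ j.succ (by simp [hij])
  · rintro ⟨hv, h0, hs⟩
    refine ⟨fun i hi ↦ ?_, fun i j hij ↦ ?_⟩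
    · obtain rfl : i = 0 := Fin.ext hi
      simpa using hv
    · induction j using Fin.cases with
      | zero => simp at hij
      | succ j =>
        induction i using Fin.cases with
        | zero => simpa using h0 j (by simpa using hij)
        | succ i => simpa using hs i j (by simpa using hij)

/-- Splitting off the first entry of a sequence. -/
def boundedStepSequencesSuccEquiv (n m : ℕ) :
    boundedStepSequences (n + 1) m ≃ Σ v : Fin (m + 1), boundedStepSequences n (v + 1) where
  toFun f :=
    have h := cons_mem_boundedStepSequences.1 ((Fin.cons_self_tail f.1).symm ▸ f.2)
    ⟨⟨f.1 0, Nat.lt_succ_of_le h.1⟩, ⟨Fin.tail f.1, h.2⟩⟩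
  invFun p := ⟨Fin.cons p.1 p.2.1,
    cons_mem_boundedStepSequences.2 ⟨Nat.le_of_lt_succ p.1.2, p.2.2⟩⟩
  left_inv f := Subtype.ext (Fin.cons_self_tail f.1)
  right_inv _ := rfl

instance finite_boundedStepSequences (n m : ℕ) : Finite (boundedStepSequences n m) := by
  induction n generalizing m with
  | zero => infer_instance
  | succ n ih => exact Finite.of_equiv _ (boundedStepSequencesSuccEquiv n m).symm

theorem card_boundedStepSequences_zero (m : ℕ) : Nat.card (boundedStepSequences 0 m) = 1 := by
  have : boundedStepSequences 0 m = Set.univ :=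
    Set.eq_univ_of_forall fun _ ↦ ⟨fun i ↦ i.elim0, fun i ↦ i.elim0⟩
  simp [this]

theorem card_boundedStepSequences_succ (n m : ℕ) :
    Nat.card (boundedStepSequences (n + 1) m) =
      ∑ v ∈ Finset.range (m + 1), Nat.card (boundedStepSequences n (v + 1)) := by
  rw [Nat.card_congr (boundedStepSequencesSuccEquiv n m), Nat.card_sigma,
    Fin.sum_univ_eq_sum_range fun v ↦ Nat.card (boundedStepSequences n (v + 1))]

/-- The ballot number formula. -/
theorem card_boundedStepSequences_mul_factorial (n m : ℕ) :
    Nat.card (boundedStepSequences n m) * (n.factorial * (n + m + 1).factorial) =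
      (m + 1) * (2 * n + m).factorial := by
  induction n generalizing m with
  | zero => rw [card_boundedStepSequences_zero]; simp [Nat.factorial_succ]
  | succ n ihn =>
    induction m with
    | zero =>
      have h := ihn 1
      rw [card_boundedStepSequences_succ, Finset.sum_range_one, Nat.factorial_succ n,
        show 2 * (n + 1) + 0 = 2 * n + 1 + 1 by ring, Nat.factorial_succ (2 * n + 1)]
      rw [show n + 1 + 0 + 1 = n + 1 + 1 by ring]
      linear_combination (n + 1) * h
    | succ m ihm =>
      have h := ihn (m + 2)
      rw [card_boundedStepSequences_succ] at ihm ⊢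
      rw [Finset.sum_range_succ]
      rw [show n + (m + 2) + 1 = n + m + 2 + 1 by ring, Nat.factorial_succ (n + m + 2),
        show 2 * n + (m + 2) = 2 * n + m + 2 by ring] at h
      rw [show n + 1 + m + 1 = n + m + 2 by ring, Nat.factorial_succ n,
        show 2 * (n + 1) + m = 2 * n + m + 2 by ring] at ihm
      rw [show n + 1 + (m + 1) + 1 = n + m + 2 + 1 by ring, Nat.factorial_succ (n + m + 2),
        Nat.factorial_succ n, show 2 * (n + 1) + (m + 1) = 2 * n + m + 2 + 1 by ring,
        Nat.factorial_succ (2 * n + m + 2)]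
      linear_combination (n + m + 3) * ihm + (n + 1) * h

/-- **The number of AoI evolutions over a horizon `H` is the Catalan number `C_H`.**
The number of sequences `(a(0), …, a(H-1))` of natural numbers with `a(0) = 0` and
`a(k+1) ≤ a(k) + 1` for all `0 ≤ k ≤ H-2` equals `C_H = (2H)! / (H! (H+1)!)`. -/
theorem card_aoi_sequences_eq_catalan (H : ℕ) :
    Nat.card {f : Fin H → ℕ //
        (∀ i : Fin H, (i : ℕ) = 0 → f i = 0) ∧
        (∀ i j : Fin H, (j : ℕ) = (i : ℕ) + 1 → f j ≤ f i + 1)} =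
      (2 * H).factorial / (H.factorial * (H + 1).factorial) := by
  have h := card_boundedStepSequences_mul_factorial H 0
  simp only [add_zero, zero_add, one_mul] at h
  rw [← h, Nat.mul_div_cancel _ (by positivity)]
  simp only [boundedStepSequences, Nat.le_zero, Set.coe_ofPred]
end

section
/- Let β ∈ ℝ, c ≥ 0, v ∈ ℝ^{1 × m} a row vector, and W ∈ ℝ^{m × m} symmetric positive definite. Then the block matrix [[β, √c · v W], [√c · W vᵀ, β W]] is positive semidefinite if and only if β ≥ 0 and β² ≥ c · (v W vᵀ). -/
open Matrix

lemma posSemidef_fin_one_iff (A : Matrix (Fin 1) (Fin 1) ℝ) : A.PosSemidef ↔ 0 ≤ A 0 0 := by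
  have hA : A = Matrix.diagonal (fun _ => A 0 0) := by
    ext i j
    fin_cases i; fin_cases j
    simp
  constructor
  · exact fun h => h.diag_nonneg
  · intro h
    rw [hA]
    exact Matrix.PosSemidef.diagonal fun _ => h

lemma row_quadratic_nonneg {m : Type*} [Fintype m] (v : Matrix (Fin 1) m ℝ)
    {W : Matrix m m ℝ} (hW : W.PosDef) : 0 ≤ (v * W * vᵀ) 0 0 := by
  simpa using (hW.posSemidef.mul_mul_conjTranspose_same v).diag_nonneg (i := 0)

lemma row_eq_zero_of_quadratic_eq_zero {m : Type*} [Fintype m] {v : Matrix (Fin 1) m ℝ}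
    {W : Matrix m m ℝ} (hW : W.PosDef) (h : (v * W * vᵀ) 0 0 = 0) : v = 0 := by
  by_contra hv
  have hv0 : v 0 ≠ 0 := by
    intro h0
    apply hv
    ext i j
    fin_cases i
    exact congrFun h0 j
  have hpos := hW.dotProduct_mulVec_pos hv0
  have heq : star (v 0) ⬝ᵥ (W *ᵥ v 0) = (v * W * vᵀ) 0 0 := by
    rw [Matrix.mul_assoc]
    rfl
  linarith

lemma mul_quadratic_nonpos_of_posSemidef_fromBlocks_zero {m : Type*} [Fintype m] {s : ℝ}
    {v : Matrix (Fin 1) m ℝ} {W : Matrix m m ℝ}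
    (h : (Matrix.fromBlocks (0 : Matrix (Fin 1) (Fin 1) ℝ) (s • (v * W))
      (s • (W * vᵀ)) 0).PosSemidef) :
    s * (v * W * vᵀ) 0 0 ≤ 0 := by
  have key := (h.conjTranspose_mul_mul_same
    (Matrix.fromRows (1 : Matrix (Fin 1) (Fin 1) ℝ) (-vᵀ))).diag_nonneg (i := 0)
  rw [Matrix.conjTranspose_fromRows_eq_fromCols_conjTranspose] at key
  simp [Matrix.fromCols_mul_fromBlocks,
    Matrix.fromCols_mul_fromRows, ← Matrix.mul_assoc] at key
  linarith

/-- **Scalar LMI block.**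
For `β ∈ ℝ`, `c ≥ 0`, a row vector `v ∈ ℝ^{1×m}` and `W` symmetric positive definite,
the block matrix `[[β, √c·vW], [√c·Wvᵀ, βW]]` is positive semidefinite iff `β ≥ 0` and
`β² ≥ c·(v W vᵀ)`. -/
theorem scalar_block_lmi_iff
    {m : ℕ} (β : ℝ) (c : ℝ) (hc : 0 ≤ c)
    (v : Matrix (Fin 1) (Fin m) ℝ)
    (W : Matrix (Fin m) (Fin m) ℝ) (hW : W.PosDef) :
    (Matrix.fromBlocks (β • (1 : Matrix (Fin 1) (Fin 1) ℝ))
        (Real.sqrt c • (v * W)) (Real.sqrt c • (W * vᵀ)) (β • W)).PosSemidef ↔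
      0 ≤ β ∧ c * (v * W * vᵀ) 0 0 ≤ β ^ 2 := by
  have hWt : Wᵀ = W := by simpa using hW.isHermitian.eq
  have hq := row_quadratic_nonneg v hW
  rcases lt_trichotomy β 0 with hβ | rfl | hβ
  · refine iff_of_false (fun h => ?_) (fun h => absurd h.1 hβ.not_ge)
    have := h.diag_nonneg (i := Sum.inl 0)
    simp at this
    linarith
  · rw [zero_smul, zero_smul]
    constructor
    · intro h
      refine ⟨le_rfl, ?_⟩
      have h1 := mul_quadratic_nonpos_of_posSemidef_fromBlocks_zero h
      nlinarith [Real.mul_self_sqrt hc, Real.sqrt_nonneg c,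
        mul_nonneg (Real.sqrt_nonneg c) (sub_nonneg.2 h1)]
    · rintro ⟨-, h⟩
      have h0 : c * (v * W * vᵀ) 0 0 = 0 :=
        le_antisymm (by simpa using h) (mul_nonneg hc hq)
      rcases mul_eq_zero.1 h0 with rfl | h0
      · simpa using Matrix.PosSemidef.zero
      · rw [row_eq_zero_of_quadratic_eq_zero hW h0]
        simpa using Matrix.PosSemidef.zero
  · have hD : (β • W).PosDef := hW.smul hβ
    have : Invertible (β • W) := hD.isUnit.invertible
    have hB : Real.sqrt c • (W * vᵀ) = (Real.sqrt c • (v * W))ᴴ := by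
      simp [hWt]
    have hdet : IsUnit W.det := (Matrix.isUnit_iff_isUnit_det _).1 hW.isUnit
    have hinv : (β • W)⁻¹ = β⁻¹ • W⁻¹ := by
      apply Matrix.inv_eq_left_inv
      simp [Matrix.nonsing_inv_mul _ hdet, smul_smul, hβ.ne']
    rw [hB, Matrix.PosDef.fromBlocks₂₂ _ _ hD, posSemidef_fin_one_iff, ← hB, hinv]
    have hS : Real.sqrt c • (v * W) * (β⁻¹ • W⁻¹) * (Real.sqrt c • (W * vᵀ)) =
        (c * β⁻¹) • (v * W * vᵀ) := by
      have hcancel : v * W * W⁻¹ = v := Matrix.mul_nonsing_inv_cancel_right _ _ hdet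
      simp only [Matrix.smul_mul, Matrix.mul_smul, smul_smul, hcancel, Matrix.mul_assoc v W vᵀ]
      congr 1
      linear_combination β⁻¹ * Real.mul_self_sqrt hc
    rw [hS]
    simp only [Matrix.sub_apply, Matrix.smul_apply, Matrix.one_apply_eq, smul_eq_mul, mul_one,
      sub_nonneg, hβ.le, true_and]
    rw [mul_right_comm, ← div_eq_mul_inv, div_le_iff₀ hβ, sq]
end

section
/- Let w be a random vector in ℝ^m with multivariate Gaussian distribution N(0, W), W ∈ ℝ^{m × m} symmetric positive definite, and let the input be u = V x_0 + N w for fixed matrices V ∈ ℝ^{n_u × n_x}, N ∈ ℝ^{n_u × m} and fixed x_0 ∈ ℝ^{n_x}. Fix a half-space constraint given by a row vector C ∈ ℝ^{1 × n_u} and scalar b ∈ ℝ, and let c ≥ 0. If the block matrix [[b − C V x_0, √c · C N W], [√c · W Nᵀ Cᵀ, (b − C V x_0) W]] is positive semidefinite, then P(C u ≤ b) ≥ Φ(√c), where Φ is the standard normal cumulative distribution function. -/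
open MeasureTheory ProbabilityTheory Matrix

/-- A measure `μ` on `ℝ^d` is the multivariate Gaussian `N(m, Σ)` iff every linear
functional `y ↦ ∑ i, l i * y i` pushes it forward to the one-dimensional Gaussian with
mean `∑ i, l i * m i` and variance `lᵀ Σ l` (Cramér–Wold characterization). -/
def IsGaussianVector {d : ℕ} (μ : Measure (Fin d → ℝ)) (m : Fin d → ℝ)
    (S : Matrix (Fin d) (Fin d) ℝ) : Prop :=
  ∀ l : Fin d → ℝ,
    μ.map (fun y => ∑ i, l i * y i) =
      gaussianReal (∑ i, l i * m i) (l ⬝ᵥ S.mulVec l).toNNReal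

/-- If `[[r, k lᵀ W], [k W l, r W]]` is positive semidefinite, then `k √(lᵀ W l) ≤ r`. -/
theorem sqrt_mul_le_of_posSemidef_fromBlocks {m : ℕ} {W : Matrix (Fin m) (Fin m) ℝ}
    (hW : W.PosSemidef) (L : Matrix (Fin 1) (Fin m) ℝ) {r k : ℝ}
    (h : (Matrix.fromBlocks (r • (1 : Matrix (Fin 1) (Fin 1) ℝ)) (k • (L * W))
      (k • (W * Lᵀ)) (r • W)).PosSemidef) :
    √(L 0 ⬝ᵥ W *ᵥ L 0) * k ≤ r := by
  set s := L 0 ⬝ᵥ W *ᵥ L 0 with hs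
  have hs0 : 0 ≤ s := by simpa using hW.dotProduct_mulVec_nonneg (L 0)
  have hLW : ((L * W) *ᵥ L 0) 0 = s := by
    rw [← mulVec_mulVec]
    rfl
  have hWL (a : ℝ) : (W * Lᵀ) *ᵥ (fun _ : Fin 1 => a) = a • W *ᵥ L 0 := by
    rw [← mulVec_mulVec, ← mulVec_smul]
    congr 1
    ext i
    simp [mulVec, dotProduct, mul_comm]
  have quad (a t : ℝ) : 0 ≤ r * a ^ 2 + 2 * a * t * k * s + r * t ^ 2 * s := by
    have := h.dotProduct_mulVec_nonneg (Sum.elim (fun _ => a) (t • L 0))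
    rw [fromBlocks_mulVec] at this
    simp only [Sum.elim_comp_inl, Sum.elim_comp_inr, star_trivial, sumElim_dotProduct_sumElim,
      smul_mulVec, one_mulVec, mulVec_smul, hWL, dotProduct_add, dotProduct_smul,
      smul_dotProduct, ← hs] at this
    simp only [dotProduct, Finset.univ_unique, Fin.default_eq_zero, Finset.sum_singleton, hLW,
      smul_eq_mul] at this
    linarith
  have hr : 0 ≤ r := by simpa using quad 1 0
  rcases hs0.eq_or_lt with hs' | hs'
  · simpa [← hs'] using hr
  · have hq := quad (√s) (-1)
    rw [Real.sq_sqrt hs0] at hq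
    refine le_of_mul_le_mul_right ?_ hs'
    linarith

/-- A centered Gaussian variable of variance `s` is at most `r` with probability at least `Φ(k)`
whenever `√s k ≤ r`. -/
theorem gaussianReal_Iic_le_of_sqrt_mul_le {s k r : ℝ} (hs : 0 ≤ s) (h : √s * k ≤ r) :
    gaussianReal 0 1 (Set.Iic k) ≤ gaussianReal 0 s.toNNReal (Set.Iic r) := by
  have hmap : (gaussianReal 0 1).map (√s * ·) = gaussianReal 0 s.toNNReal := by
    rw [gaussianReal_map_const_mul, mul_zero, mul_one]
    congr 1
    ext
    simp [hs]
  rw [← hmap, Measure.map_apply (by fun_prop) measurableSet_Iic]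
  refine measure_mono fun x (hx : x ≤ k) => ?_
  exact (mul_le_mul_of_nonneg_left hx (Real.sqrt_nonneg s)).trans h

/-- **LMI implies chance-constraint satisfaction for the input.**
Let `w ~ N(0, W)` with `W` symmetric positive definite and `u = V x₀ + N w`. If for a
half-space `{u | C u ≤ b}` and `c ≥ 0` the block matrix
`[[b - C V x₀, √c · C N W], [√c · W Nᵀ Cᵀ, (b - C V x₀) W]]` is positive semidefinite,
then `P(C u ≤ b) ≥ Φ(√c)`, with `Φ` the standard normal CDF. -/
theorem lmi_implies_input_chance_constraint
    {Ω : Type*} [MeasurableSpace Ω] (P : Measure Ω) [IsProbabilityMeasure P]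
    {m nu nx : ℕ}
    (W : Matrix (Fin m) (Fin m) ℝ) (hW : W.PosDef) (hWsymm : W.IsSymm)
    (w : Ω → Fin m → ℝ) (hw : Measurable w)
    (hwG : IsGaussianVector (P.map w) 0 W)
    (V : Matrix (Fin nu) (Fin nx) ℝ) (N : Matrix (Fin nu) (Fin m) ℝ)
    (x0 : Fin nx → ℝ)
    (u : Ω → Fin nu → ℝ)
    (hu : ∀ ω, u ω = V.mulVec x0 + N.mulVec (w ω))
    (C : Matrix (Fin 1) (Fin nu) ℝ) (b c : ℝ) (hc : 0 ≤ c)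
    (hLMI : (Matrix.fromBlocks
        ((b - (C * V).mulVec x0 0) • (1 : Matrix (Fin 1) (Fin 1) ℝ))
        (Real.sqrt c • (C * N * W))
        (Real.sqrt c • (W * Nᵀ * Cᵀ))
        ((b - (C * V).mulVec x0 0) • W)).PosSemidef) :
    gaussianReal 0 1 (Set.Iic (Real.sqrt c)) ≤ P {ω | C.mulVec (u ω) 0 ≤ b} := by
  have hs : 0 ≤ (C * N) 0 ⬝ᵥ W *ᵥ (C * N) 0 := by
    simpa using hW.posSemidef.dotProduct_mulVec_nonneg ((C * N) 0)
  rw [Matrix.mul_assoc W, ← transpose_mul] at hLMI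
  refine (gaussianReal_Iic_le_of_sqrt_mul_le hs
    (sqrt_mul_le_of_posSemidef_fromBlocks hW.posSemidef (C * N) hLMI)).trans_eq ?_
  have hlaw := hwG ((C * N) 0)
  simp only [Pi.zero_apply, mul_zero, Finset.sum_const_zero] at hlaw
  rw [← hlaw, Measure.map_map (by fun_prop) hw,
    Measure.map_apply (by fun_prop) measurableSet_Iic]
  congr 1
  ext ω
  have hCu : (C *ᵥ u ω) 0 = ((C * V) *ᵥ x0) 0 + ∑ i, (C * N) 0 i * w ω i := by
    rw [hu, mulVec_add, mulVec_mulVec, mulVec_mulVec]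
    rfl
  simp only [Set.mem_preimage, Set.mem_Iic, Set.mem_ofPred_eq, hCu, Function.comp_apply,
    le_sub_iff_add_le']
end
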